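/- arXiv:1906.08503 — 2 statements merged into one kernel-verified Lean document; each statement's English description precedes it below -/
import Mathlib

section
/- Let α ∈ (0,1) and μ ≥ 0. Then for all t > 0 the relaxation function satisfies the two-sided algebraic decay bounds 1/(1 + μ·Γ(1−α)·t^α) ≤ E_α(−μ t^α) ≤ 1/(1 + μ·Γ(1+α)^{−1}·t^α). -/
open Set

/-- The Mittag-Leffler function `E_α(z) = ∑_{j=0}^∞ z^j / Γ(αj+1)`. -/
noncomputable def mittagLeffler (α z : ℝ) : ℝ := ∑' j : ℕ, z ^ j / Real.Gamma (α * j + 1)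

/-- The coefficients of `(1-z)^(-a)`. -/
noncomputable def pc (a : ℝ) (n : ℕ) : ℝ := ∏ j ∈ Finset.range n, (a + j) / (j + 1)

lemma pc_zero (a : ℝ) : pc a 0 = 1 := by simp [pc]

lemma pc_succ (a : ℝ) (n : ℕ) : pc a (n+1) = pc a n * ((a + n) / (n + 1)) := by
  rw [pc, Finset.prod_range_succ, pc]

lemma pc_succ' (a : ℝ) (n : ℕ) : ((n+1 : ℕ) : ℝ) * pc a (n+1) = (a + n) * pc a n := by
  rw [pc_succ]; push_cast
  have : (n:ℝ) + 1 ≠ 0 := by positivity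
  field_simp

lemma pc_pos {a : ℝ} (ha : 0 < a) (n : ℕ) : 0 < pc a n :=
  Finset.prod_pos fun j _ => by positivity

lemma pc_one (n : ℕ) : pc 1 n = 1 := by
  refine Finset.prod_eq_one fun j _ => ?_
  rw [add_comm]; exact div_self (by positivity)

lemma pc_at_zero (n : ℕ) : pc 0 (n+1) = 0 := by
  simp [pc, Finset.prod_range_succ']

lemma pc_neg {α : ℝ} (h0 : 0 < α) (h1 : α < 1) (n : ℕ) : pc (-α) (n+1) ≤ 0 := by
  rw [pc, Finset.prod_range_succ']
  refine mul_nonpos_of_nonneg_of_nonpos (Finset.prod_nonneg fun j _ => ?_) ?_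
  · push_cast
    have : (0:ℝ) ≤ j := j.cast_nonneg
    apply div_nonneg <;> linarith
  · simp; exact h0.le

lemma pc_anti {a : ℝ} (h0 : 0 < a) (h1 : a ≤ 1) : Antitone (pc a) := by
  refine antitone_nat_of_succ_le fun n => ?_
  rw [pc_succ]
  refine mul_le_of_le_one_right (pc_pos h0 n).le ?_
  rw [div_le_one (by positivity)]; linarith

lemma pc_abs (a : ℝ) (n : ℕ) : |pc a n| ≤ (1 + |a|) ^ n := by
  rw [pc, Finset.abs_prod]
  calc _ ≤ ∏ j ∈ Finset.range n, (1 + |a|) := by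
        refine Finset.prod_le_prod (fun _ _ => abs_nonneg _) fun j _ => ?_
        have hj : (0:ℝ) ≤ j := j.cast_nonneg
        rw [abs_div, abs_of_pos (show (0:ℝ) < j + 1 by positivity), div_le_iff₀ (by positivity)]
        have := abs_add_le a j
        rw [abs_of_nonneg hj] at this
        nlinarith [abs_nonneg a, mul_nonneg (abs_nonneg a) hj]
    _ = _ := by simp

open Finset in
lemma pc_conv (a b : ℝ) (n : ℕ) :
    ∑ q ∈ Finset.HasAntidiagonal.antidiagonal n, pc a q.1 * pc b q.2 = pc (a + b) n := by
  induction n with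
  | zero => simp [pc_zero]
  | succ n ih =>
    have hn : ((n+1 : ℕ) : ℝ) ≠ 0 := by positivity
    apply mul_left_cancel₀ hn
    rw [pc_succ', ← ih, mul_sum, mul_sum]
    have e1 : ∑ q ∈ Finset.HasAntidiagonal.antidiagonal (n+1), ((n+1:ℕ):ℝ) * (pc a q.1 * pc b q.2)
        = ∑ q ∈ Finset.HasAntidiagonal.antidiagonal (n+1), ((q.1:ℝ) * pc a q.1) * pc b q.2
          + ∑ q ∈ Finset.HasAntidiagonal.antidiagonal (n+1), pc a q.1 * ((q.2:ℝ) * pc b q.2) := by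
      rw [← sum_add_distrib]
      refine sum_congr rfl fun q hq => ?_
      rw [← Finset.HasAntidiagonal.mem_antidiagonal.1 hq]; push_cast; ring
    rw [e1, Nat.sum_antidiagonal_succ, Nat.sum_antidiagonal_succ']
    simp only [pc_succ']
    simp only [Nat.cast_zero, zero_mul, mul_zero, zero_add]
    rw [← sum_add_distrib]
    refine sum_congr rfl fun q hq => ?_
    rw [← Finset.HasAntidiagonal.mem_antidiagonal.1 hq]; push_cast; ring

lemma summable_poly_geom (n : ℕ) {r : ℝ} (h0 : 0 ≤ r) (h1 : r < 1) :
    Summable fun k : ℕ => ((k:ℝ) + 1) ^ n * r ^ k := by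
  have hr : ‖r‖ < 1 := by rwa [Real.norm_of_nonneg h0]
  have s1 := summable_pow_mul_geometric_of_norm_lt_one n hr
  have s2 := summable_geometric_of_lt_one h0 h1
  refine Summable.of_nonneg_of_le (fun k => by positivity) (fun k => ?_)
    ((s1.add s2).mul_left ((2:ℝ) ^ n))
  have : ((k:ℝ) + 1) ^ n ≤ 2 ^ n * (k ^ n + 1) := by
    rcases Nat.eq_zero_or_pos k with rfl | hk
    · have : (1:ℝ) ≤ 2 ^ n := one_le_pow₀ (by norm_num)
      have h3 : (0:ℝ) ≤ 0 ^ n := by positivity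
      simp only [Nat.cast_zero, zero_add, one_pow]
      nlinarith
    · have hk : (1:ℝ) ≤ k := by exact_mod_cast hk
      calc ((k:ℝ) + 1) ^ n ≤ (2 * k) ^ n := by gcongr; linarith
        _ = 2 ^ n * k ^ n := mul_pow _ _ _
        _ ≤ _ := by gcongr; linarith
  calc _ ≤ 2 ^ n * ((k:ℝ) ^ n + 1) * r ^ k := by gcongr
    _ = _ := by ring

/-- Coefficients of `(1-z)^(α-b) / ((1-z)^α + c)`. -/
noncomputable def TT (α c b : ℝ) (n : ℕ) : ℝ := ∑' k : ℕ, (-c) ^ k * pc (α * k + b) n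

lemma TT_summable {α c : ℝ} (b : ℝ) (hα : 0 < α) (hc : 0 ≤ c) (hc1 : c < 1) (n : ℕ) :
    Summable fun k : ℕ => (-c) ^ k * pc (α * k + b) n := by
  refine Summable.of_norm_bounded
    ((summable_poly_geom n hc hc1).mul_left ((1 + α + |b|) ^ n)) fun k => ?_
  rw [norm_mul, norm_pow, norm_neg, Real.norm_of_nonneg hc, Real.norm_eq_abs]
  have hk : (0:ℝ) ≤ k := k.cast_nonneg
  have h := pc_abs (α * k + b) n
  have h2 : 1 + |α * k + b| ≤ (1 + α + |b|) * (k + 1) := by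
    have := abs_add_le (α * k) b
    rw [abs_of_nonneg (by positivity : 0 ≤ α * k)] at this
    nlinarith [abs_nonneg b, mul_nonneg (abs_nonneg b) hk]
  calc c ^ k * |pc (α * k + b) n| ≤ c ^ k * ((1 + α + |b|) * (k + 1)) ^ n := by
        gcongr; exact h.trans (by gcongr)
    _ = _ := by rw [mul_pow]; ring

open Finset in
lemma TT_conv {α c : ℝ} (b d : ℝ) (hα : 0 < α) (hc : 0 ≤ c) (hc1 : c < 1) (n : ℕ) :
    ∑ q ∈ Finset.HasAntidiagonal.antidiagonal n, pc d q.1 * TT α c b q.2 = TT α c (b + d) n := by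
  unfold TT
  simp_rw [← tsum_mul_left]
  have hs : ∀ q ∈ Finset.HasAntidiagonal.antidiagonal n,
      Summable fun k : ℕ => pc d q.1 * ((-c) ^ k * pc (α * k + b) q.2) :=
    fun q _ => (TT_summable b hα hc hc1 q.2).mul_left (pc d q.1)
  rw [← Summable.tsum_finsetSum hs]
  refine tsum_congr fun k => ?_
  rw [show α * k + (b + d) = d + (α * k + b) by ring, ← pc_conv, mul_sum]
  exact sum_congr rfl fun q _ => by ring

lemma TT_shift {α c : ℝ} (b : ℝ) (hα : 0 < α) (hc : 0 ≤ c) (hc1 : c < 1) (n : ℕ) :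
    TT α c b n = pc b n - c * TT α c (b + α) n := by
  unfold TT
  rw [(TT_summable b hα hc hc1 n).tsum_eq_zero_add, ← tsum_mul_left, sub_eq_add_neg, ← tsum_neg]
  congr 1
  · simp
  · refine tsum_congr fun k => ?_
    rw [show α * k + (b + α) = α * ((k+1:ℕ):ℝ) + b by push_cast; ring]
    ring

open Finset in
lemma W_nonneg {α c : ℝ} (hα : 0 < α) (hα1 : α < 1) (hc : 0 ≤ c) (hc1 : c < 1) (n : ℕ) :
    0 ≤ TT α c α n := by
  induction n using Nat.strong_induction_on with
  | _ n ih =>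
    have h1 := TT_conv α (-α) hα hc hc1 n
    have h2 := TT_shift 0 hα hc hc1 n
    rw [add_neg_cancel] at h1
    rw [zero_add] at h2
    rw [h2] at h1
    rcases n with _ | n
    · simp [pc_zero] at h1
      nlinarith
    · rw [Nat.sum_antidiagonal_succ, pc_at_zero, pc_zero] at h1
      have h3 : ∑ q ∈ Finset.HasAntidiagonal.antidiagonal n, pc (-α) (q.1+1) * TT α c α q.2 ≤ 0 := by
        refine sum_nonpos fun q hq => ?_
        have := Finset.HasAntidiagonal.mem_antidiagonal.1 hq
        exact mul_nonpos_of_nonpos_of_nonneg (pc_neg hα hα1 _) (ih _ (by omega))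
      simp only at h1
      by_contra hneg
      push Not at hneg
      nlinarith

open Finset in
lemma TT_cum {α c : ℝ} (hα : 0 < α) (hc : 0 ≤ c) (hc1 : c < 1) (n : ℕ) :
    TT α c (1 + α) n = ∑ q ∈ Finset.HasAntidiagonal.antidiagonal n, TT α c α q.2 := by
  rw [add_comm, ← TT_conv α 1 hα hc hc1 n]
  simp [pc_one]

open Finset in
lemma disc_upper {α c : ℝ} (hα : 0 < α) (hα1 : α < 1) (hc : 0 ≤ c) (hc1 : c < 1) (n : ℕ) :
    TT α c 1 n * (1 + c * pc (1 + α) n) ≤ 1 := by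
  have hanti : Antitone (TT α c 1) := by
    refine antitone_nat_of_succ_le fun m => ?_
    rw [TT_shift 1 hα hc hc1, TT_shift 1 hα hc hc1 m, pc_one, pc_one, TT_cum hα hc hc1,
      TT_cum hα hc hc1, Nat.sum_antidiagonal_succ]
    have := mul_nonneg hc (W_nonneg hα hα1 hc hc1 (m+1))
    simp only
    linarith
  have h1 := TT_shift 1 hα hc hc1 n
  rw [pc_one, ← TT_conv 1 α hα hc hc1 n] at h1
  have h2 : pc (1 + α) n * TT α c 1 n ≤ ∑ q ∈ Finset.HasAntidiagonal.antidiagonal n, pc α q.1 * TT α c 1 q.2 := by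
    rw [add_comm, ← pc_conv, sum_mul]
    refine sum_le_sum fun q hq => ?_
    rw [pc_one, mul_one]
    have := Finset.HasAntidiagonal.mem_antidiagonal.1 hq
    exact mul_le_mul_of_nonneg_left (hanti (by omega)) (pc_pos hα _).le
  nlinarith [mul_le_mul_of_nonneg_left h2 hc]

open Finset in
lemma disc_lower {α c : ℝ} (hα : 0 < α) (hα1 : α < 1) (hc : 0 ≤ c) (hc1 : c < 1) (n : ℕ) :
    pc (1 - α) n ≤ TT α c 1 n * (pc (1 - α) n + c) := by
  have h1 := TT_shift 1 hα hc hc1 n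
  rw [pc_one, TT_cum hα hc hc1] at h1
  have h2 := TT_conv α (1 - α) hα hc hc1 n
  rw [add_sub_cancel] at h2
  have h3 : pc (1 - α) n * ∑ q ∈ Finset.HasAntidiagonal.antidiagonal n, TT α c α q.2 ≤ TT α c 1 n := by
    rw [← h2, mul_sum]
    refine sum_le_sum fun q hq => ?_
    have := Finset.HasAntidiagonal.mem_antidiagonal.1 hq
    exact mul_le_mul_of_nonneg_right (pc_anti (by linarith) (by linarith) (by omega))
      (W_nonneg hα hα1 hc hc1 _)
  have h4 := mul_le_mul_of_nonneg_left h3 hc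
  have h5 : c * (pc (1 - α) n * ∑ q ∈ Finset.HasAntidiagonal.antidiagonal n, TT α c α q.2)
      = pc (1 - α) n * (1 - TT α c 1 n) := by rw [h1]; ring
  linarith

open Filter Topology in
lemma pc_lim {s : ℝ} (hs : 0 < s) :
    Tendsto (fun n : ℕ => pc s n * (n:ℝ) ^ (1 - s)) atTop (𝓝 (1 / Real.Gamma s)) := by
  have h1 : Tendsto (fun n : ℕ => (n:ℝ) / (n + s)) atTop (𝓝 1) :=
    tendsto_natCast_div_add_atTop s
  have h2 := h1.div (Real.GammaSeq_tendsto_Gamma s) (Real.Gamma_pos_of_pos hs).ne'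
  refine h2.congr' ?_
  filter_upwards [eventually_gt_atTop 0] with n hn
  have hn' : (0:ℝ) < n := by exact_mod_cast hn
  have hfac : ∏ j ∈ Finset.range n, ((j:ℝ) + 1) = (n.factorial : ℝ) := by
    rw [← Finset.prod_range_add_one_eq_factorial]; push_cast; rfl
  have hp : 0 < ∏ j ∈ Finset.range n, (s + (j:ℝ)) :=
    Finset.prod_pos fun j _ => by positivity
  have hf : (0:ℝ) < n.factorial := by positivity
  have hr : 0 < (n:ℝ) ^ s := by positivity
  simp only [Pi.div_apply, Real.GammaSeq, pc, Finset.prod_div_distrib, hfac,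
    Finset.prod_range_succ, Real.rpow_sub hn', Real.rpow_one]
  rw [add_comm (n:ℝ) s]
  have : 0 < s + n := by positivity
  field_simp

lemma pc_bound {y : ℝ} (hy : 0 ≤ y) {M n : ℕ} (hM : 0 < M) (hn : M ≤ n) :
    pc (y + 1) n ≤ (1 + y) ^ M * ((n:ℝ) / M) ^ y := by
  have hM' : (0:ℝ) < M := by exact_mod_cast hM
  induction n, hn using Nat.le_induction with
  | base =>
    rw [div_self hM'.ne', Real.one_rpow, mul_one, pc]
    calc _ ≤ ∏ j ∈ Finset.range M, (1 + y) := by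
          refine Finset.prod_le_prod (fun j _ => by positivity) fun j _ => ?_
          rw [div_le_iff₀ (by positivity)]
          nlinarith [mul_nonneg hy (j.cast_nonneg : (0:ℝ) ≤ j)]
      _ = _ := by simp
  | succ n hn ih =>
    have hn' : (0:ℝ) < n := by exact_mod_cast hM.trans_le hn
    have key : (y + 1 + n) / (n + 1) ≤ (((n:ℝ) + 1) / n) ^ y := by
      rw [Real.rpow_def_of_pos (by positivity)]
      have h1 := Real.one_sub_inv_le_log_of_pos (show 0 < ((n:ℝ) + 1) / n by positivity)
      have h2 := Real.add_one_le_exp (Real.log (((n:ℝ) + 1) / n) * y)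
      have h3 : (y + 1 + n) / ((n:ℝ) + 1) = (1 - (((n:ℝ) + 1) / n)⁻¹) * y + 1 := by
        field_simp; ring
      rw [h3]
      nlinarith
    rw [pc_succ]
    calc _ ≤ ((1 + y) ^ M * ((n:ℝ) / M) ^ y) * (((n:ℝ) + 1) / n) ^ y := by gcongr
      _ = (1 + y) ^ M * (((n:ℝ) / M) * (((n:ℝ) + 1) / n)) ^ y := by
          rw [Real.mul_rpow (by positivity) (by positivity)]; ring
      _ = _ := by
          congr 2; push_cast; field_simp

open Filter Topology in
lemma TT_lim {α x : ℝ} (hα : 0 < α) (hx : 0 ≤ x) :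
    Tendsto (fun n : ℕ => TT α (x / (n:ℝ) ^ α) 1 n) atTop (𝓝 (mittagLeffler α (-x))) := by
  have hlim : Tendsto (fun M : ℕ => x / (M:ℝ) ^ α) atTop (𝓝 0) :=
    ((tendsto_rpow_atTop hα).comp tendsto_natCast_atTop_atTop).const_div_atTop x
  obtain ⟨M, hM1, hM0⟩ := ((hlim.eventually_lt_const one_pos).and (eventually_gt_atTop 0)).exists
  have hM' : (0:ℝ) < M := by exact_mod_cast hM0
  have hr0 : 0 ≤ x / (M:ℝ) ^ α := by positivity
  unfold TT mittagLeffler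
  refine tendsto_tsum_of_dominated_convergence
    (bound := fun k : ℕ => (1 + α) ^ M * (((k:ℝ) + 1) ^ M * (x / (M:ℝ) ^ α) ^ k))
    ((summable_poly_geom M hr0 hM1).mul_left _) (fun k => ?_) ?_
  · have h := (pc_lim (s := α * k + 1) (by positivity)).const_mul ((-x) ^ k)
    rw [mul_one_div] at h
    refine h.congr' ?_
    filter_upwards [eventually_gt_atTop 0] with n hn
    have hn' : (0:ℝ) < n := by exact_mod_cast hn
    rw [show 1 - (α * k + 1) = -(α * k) by ring, Real.rpow_neg hn'.le, Real.rpow_mul hn'.le,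
      Real.rpow_natCast, ← neg_div, div_pow]
    ring
  · filter_upwards [eventually_ge_atTop M] with n hn k
    have hn' : (0:ℝ) < n := by exact_mod_cast hM0.trans_le hn
    have hk : (0:ℝ) ≤ k := k.cast_nonneg
    have hb := pc_bound (y := α * k) (by positivity) hM0 hn
    rw [norm_mul, norm_pow, norm_neg, Real.norm_of_nonneg (by positivity),
      Real.norm_of_nonneg (pc_pos (by positivity) n).le]
    rw [Real.rpow_mul (by positivity), Real.rpow_natCast, Real.div_rpow hn'.le hM'.le] at hb
    have hna : 0 < (n:ℝ) ^ α := by positivity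
    have hma : 0 < (M:ℝ) ^ α := by positivity
    calc _ ≤ (x / (n:ℝ) ^ α) ^ k * ((1 + α * k) ^ M * ((n:ℝ) ^ α / (M:ℝ) ^ α) ^ k) := by gcongr
      _ = (1 + α * k) ^ M * ((x / (n:ℝ) ^ α) * ((n:ℝ) ^ α / (M:ℝ) ^ α)) ^ k := by
          rw [mul_pow]; ring
      _ = (1 + α * k) ^ M * (x / (M:ℝ) ^ α) ^ k := by
          congr 2; field_simp
      _ ≤ ((1 + α) * (k + 1)) ^ M * (x / (M:ℝ) ^ α) ^ k := by gcongr; nlinarith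
      _ = _ := by rw [mul_pow]; ring

open Filter Topology in
lemma ml_bounds {α x : ℝ} (hα : 0 < α) (hα1 : α < 1) (hx : 0 ≤ x) :
    1 ≤ mittagLeffler α (-x) * (1 + Real.Gamma (1 - α) * x) ∧
    mittagLeffler α (-x) * (1 + (Real.Gamma (1 + α))⁻¹ * x) ≤ 1 := by
  have hlim : Tendsto (fun M : ℕ => x / (M:ℝ) ^ α) atTop (𝓝 0) :=
    ((tendsto_rpow_atTop hα).comp tendsto_natCast_atTop_atTop).const_div_atTop x
  have hT := TT_lim hα hx
  have hG := Real.Gamma_pos_of_pos (show 0 < 1 - α by linarith)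
  constructor
  · have h1 := pc_lim (s := 1 - α) (by linarith)
    have h2 := hT.mul (h1.add_const x)
    have h3 := le_of_tendsto_of_tendsto h1 h2 (by
      filter_upwards [hlim.eventually_lt_const one_pos, eventually_gt_atTop 0] with n hc hn
      have hn' : (0:ℝ) < n := by exact_mod_cast hn
      have hna : 0 < (n:ℝ) ^ α := by positivity
      have := mul_le_mul_of_nonneg_right
        (disc_lower hα hα1 (by positivity) hc n) hna.le
      rw [sub_sub_cancel]
      refine this.trans_eq ?_
      rw [mul_assoc, add_mul, div_mul_cancel₀ _ hna.ne'])
    have h4 := mul_le_mul_of_nonneg_left h3 hG.le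
    rw [mul_one_div_cancel hG.ne'] at h4
    refine h4.trans_eq ?_
    field_simp
  · have h1 := pc_lim (s := 1 + α) (by linarith)
    have h2 := hT.mul ((h1.mul_const x).const_add 1)
    rw [one_div] at h2
    refine le_of_tendsto h2 ?_
    filter_upwards [hlim.eventually_lt_const one_pos, eventually_gt_atTop 0] with n hc hn
    have hn' : (0:ℝ) < n := by exact_mod_cast hn
    have hna : 0 < (n:ℝ) ^ α := by positivity
    refine le_trans (le_of_eq ?_) (disc_upper hα hα1 (by positivity) hc n)
    rw [show 1 - (1 + α) = -α by ring, Real.rpow_neg hn'.le]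
    ring

/-- Two-sided algebraic decay bounds for the relaxation function:
`1/(1 + μ Γ(1-α) t^α) ≤ E_α(-μ t^α) ≤ 1/(1 + μ Γ(1+α)⁻¹ t^α)` for `t > 0`. -/
theorem relaxation_two_sided_bounds (α μ : ℝ) (hα : α ∈ Ioo (0:ℝ) 1) (hμ : 0 ≤ μ) :
    ∀ t : ℝ, 0 < t →
      1 / (1 + μ * Real.Gamma (1 - α) * t ^ α) ≤ mittagLeffler α (-μ * t ^ α) ∧
      mittagLeffler α (-μ * t ^ α) ≤ 1 / (1 + μ * (Real.Gamma (1 + α))⁻¹ * t ^ α) := by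
  intro t ht
  obtain ⟨h0, h1⟩ := hα
  have hta : 0 < t ^ α := by positivity
  obtain ⟨hl, hu⟩ := ml_bounds h0 h1 (mul_nonneg hμ hta.le)
  have hG := Real.Gamma_pos_of_pos (show 0 < 1 - α by linarith)
  have hG' := Real.Gamma_pos_of_pos (show 0 < 1 + α by linarith)
  rw [neg_mul]
  constructor
  · rw [div_le_iff₀ (by positivity)]
    refine hl.trans_eq ?_
    ring
  · rw [le_div_iff₀ (by positivity)]
    refine le_trans (le_of_eq ?_) hu
    ring
end

section
/- Let α ∈ (0,1), let H be a separable real Hilbert space with inner product (·|·), let (φ_n)_{n∈ℕ} be an orthonormal basis of H, and let (λ_n)_{n∈ℕ} be real numbers with λ_n ≥ λ₁ > 0 for all n. For u₀ ∈ H and t ≥ 0, the series u(t) = ∑_{n=1}^∞ E_α(−λ_n t^α)·(u₀|φ_n)·φ_n converges in H and satisfies the decay estimate ‖u(t)‖_H ≤ E_α(−λ₁ t^α)·‖u₀‖_H. -/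
open MeasureTheory Set
open scoped RealInnerProductSpace

/-- Coefficients of `(1 - z)^(-s)`. -/
noncomputable def dcoef (s : ℝ) (n : ℕ) : ℝ := ∏ k ∈ Finset.range n, (s + k) / (k + 1)

lemma dcoef_zero (s : ℝ) : dcoef s 0 = 1 := by simp [dcoef]

lemma dcoef_succ (s : ℝ) (n : ℕ) : ((n : ℝ) + 1) * dcoef s (n + 1) = (s + n) * dcoef s n := by
  have : (n : ℝ) + 1 ≠ 0 := by positivity
  rw [dcoef, Finset.prod_range_succ, ← dcoef]
  field_simp

lemma dcoef_conv (s s' : ℝ) (n : ℕ) :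
    ∑ p ∈ Finset.HasAntidiagonal.antidiagonal n, dcoef s p.1 * dcoef s' p.2 = dcoef (s + s') n := by
  induction n with
  | zero => simp [dcoef_zero]
  | succ n ih =>
    have hn : (n : ℝ) + 1 ≠ 0 := by positivity
    apply mul_left_cancel₀ hn
    rw [dcoef_succ, ← ih, Finset.mul_sum, Finset.mul_sum]
    have h1 : ∑ p ∈ Finset.HasAntidiagonal.antidiagonal (n + 1), ((n : ℝ) + 1) * (dcoef s p.1 * dcoef s' p.2)
        = ∑ p ∈ Finset.HasAntidiagonal.antidiagonal (n + 1), (p.1 : ℝ) * dcoef s p.1 * dcoef s' p.2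
          + ∑ p ∈ Finset.HasAntidiagonal.antidiagonal (n + 1), dcoef s p.1 * ((p.2 : ℝ) * dcoef s' p.2) := by
      rw [← Finset.sum_add_distrib]
      refine Finset.sum_congr rfl fun p hp => ?_
      have h : (p.1 : ℝ) + p.2 = n + 1 := by exact_mod_cast Finset.HasAntidiagonal.mem_antidiagonal.1 hp
      rw [← h]; ring
    rw [h1, Finset.Nat.sum_antidiagonal_succ, Finset.Nat.sum_antidiagonal_succ']
    push_cast
    simp only [dcoef_succ, zero_mul, mul_zero, zero_add]
    rw [← Finset.sum_add_distrib]
    refine Finset.sum_congr rfl fun p hp => ?_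
    have h : (p.1 : ℝ) + p.2 = n := by exact_mod_cast Finset.HasAntidiagonal.mem_antidiagonal.1 hp
    rw [← h]; ring

lemma dcoef_nonneg {s : ℝ} (hs : 0 ≤ s) (n : ℕ) : 0 ≤ dcoef s n :=
  Finset.prod_nonneg fun k _ => by positivity

lemma dcoef_neg {α : ℝ} (h0 : 0 < α) (h1 : α < 1) (n : ℕ) : dcoef (-α) (n + 1) ≤ 0 := by
  rw [dcoef, Finset.prod_range_succ']
  refine mul_nonpos_of_nonneg_of_nonpos (Finset.prod_nonneg fun k _ => ?_) (by simp; exact h0.le)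
  have : (0 : ℝ) ≤ k := by positivity
  push_cast
  exact div_nonneg (by linarith) (by linarith)

lemma dcoef_le {α : ℝ} (h0 : 0 < α) (h1 : α < 1) (n j : ℕ) :
    dcoef (1 + α * j) n ≤ ((j : ℝ) + 1) ^ n := by
  have : ((j : ℝ) + 1) ^ n = ∏ k ∈ Finset.range n, ((j : ℝ) + 1) := by simp
  rw [this, dcoef]
  refine Finset.prod_le_prod (fun k _ => by positivity) fun k _ => ?_
  rw [div_le_iff₀ (by positivity)]
  have hj : (0 : ℝ) ≤ j := by positivity
  have hk : (0 : ℝ) ≤ k := by positivity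
  nlinarith [mul_nonneg hj hk, mul_le_mul_of_nonneg_right h1.le hj]

lemma summable_dcoef {α : ℝ} (h0 : 0 < α) (h1 : α < 1) (n : ℕ) {m : ℝ} (hm : 0 ≤ m)
    (hm1 : m < 1) : Summable fun j : ℕ => m ^ j * dcoef (1 + α * j) n := by
  have hn : ‖m‖ < 1 := by rwa [Real.norm_of_nonneg hm]
  have hs := ((summable_pow_mul_geometric_of_norm_lt_one n hn).add
    (summable_pow_mul_geometric_of_norm_lt_one 0 hn)).mul_left (2 ^ n)
  refine Summable.of_nonneg_of_le (fun j => mul_nonneg (by positivity)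
    (dcoef_nonneg (by positivity) n)) (fun j => ?_) hs
  have h2 : ((j : ℝ) + 1) ^ n ≤ 2 ^ n * ((j : ℝ) ^ n + 1) := by
    rcases Nat.eq_zero_or_pos j with rfl | hj
    · have : (1 : ℝ) ≤ 2 ^ n := one_le_pow₀ (by norm_num)
      have : (0 : ℝ) ≤ 0 ^ n := by positivity
      push_cast
      rw [zero_add, one_pow]
      nlinarith
    · have hj' : (1 : ℝ) ≤ j := by exact_mod_cast hj
      calc ((j : ℝ) + 1) ^ n ≤ (2 * j) ^ n := by gcongr; linarith
        _ = 2 ^ n * (j : ℝ) ^ n := mul_pow _ _ _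
        _ ≤ _ := by gcongr; linarith
  have h3 := (dcoef_le h0 h1 n j).trans h2
  have := mul_le_mul_of_nonneg_left h3 (pow_nonneg hm j)
  refine this.trans (le_of_eq ?_)
  ring

/-- Discrete approximations of the Mittag-Leffler function. -/
noncomputable def aseq (α m : ℝ) (n : ℕ) : ℝ := ∑' j : ℕ, (-m) ^ j * dcoef (1 + α * j) n

lemma summable_aseq {α : ℝ} (h0 : 0 < α) (h1 : α < 1) (n : ℕ) {m : ℝ} (hm : 0 ≤ m)
    (hm1 : m < 1) : Summable fun j : ℕ => (-m) ^ j * dcoef (1 + α * j) n := by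
  refine Summable.of_norm ?_
  refine (summable_dcoef h0 h1 n hm hm1).congr fun j => ?_
  rw [norm_mul, norm_pow, norm_neg, Real.norm_of_nonneg hm,
    Real.norm_of_nonneg (dcoef_nonneg (by positivity) n)]

lemma aseq_conv {α : ℝ} (h0 : 0 < α) (h1 : α < 1) (n : ℕ) {m : ℝ} (hm : 0 ≤ m)
    (hm1 : m < 1) : ∑ p ∈ Finset.HasAntidiagonal.antidiagonal n, dcoef (-α) p.1 * aseq α m p.2
      = dcoef (1 - α) n - m * aseq α m n := by
  have hs : ∀ p ∈ Finset.HasAntidiagonal.antidiagonal n, HasSum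
      (fun j : ℕ => dcoef (-α) p.1 * ((-m) ^ j * dcoef (1 + α * j) p.2))
      (dcoef (-α) p.1 * aseq α m p.2) := fun p _ =>
    (summable_aseq h0 h1 p.2 hm hm1).hasSum.mul_left _
  have h := hasSum_sum hs
  have h2 : HasSum (fun j : ℕ => (-m) ^ j * dcoef (1 - α + α * j) n)
      (∑ p ∈ Finset.HasAntidiagonal.antidiagonal n, dcoef (-α) p.1 * aseq α m p.2) := by
    refine h.congr_fun ?_
    intro j
    rw [show 1 - α + α * j = -α + (1 + α * j) by ring, ← dcoef_conv, Finset.mul_sum]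
    exact Finset.sum_congr rfl fun p _ => by ring
  have h3 : HasSum (fun j : ℕ => (-m) ^ j * dcoef (1 - α + α * j) n)
      (dcoef (1 - α) n - m * aseq α m n) := by
    rw [← hasSum_nat_add_iff' 1]
    have := (summable_aseq h0 h1 n hm hm1).hasSum.mul_left (-m)
    convert this using 1
    · rfl
    · funext j
      push_cast
      rw [show 1 - α + α * ((j : ℝ) + 1) = 1 + α * j by ring]
      ring
    · simp [aseq]
  exact h2.unique h3

lemma aseq_rec {α : ℝ} (h0 : 0 < α) (h1 : α < 1) (n : ℕ) {m : ℝ} (hm : 0 ≤ m)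
    (hm1 : m < 1) : (1 + m) * aseq α m (n + 1) = dcoef (1 - α) (n + 1)
      + ∑ p ∈ Finset.HasAntidiagonal.antidiagonal n, (-dcoef (-α) (p.1 + 1)) * aseq α m p.2 := by
  have := aseq_conv h0 h1 (n + 1) hm hm1
  rw [Finset.Nat.sum_antidiagonal_succ, dcoef_zero] at this
  simp only [neg_mul, Finset.sum_neg_distrib]
  linarith

lemma aseq_rec_zero {α : ℝ} (h0 : 0 < α) (h1 : α < 1) {m : ℝ} (hm : 0 ≤ m)
    (hm1 : m < 1) : (1 + m) * aseq α m 0 = 1 := by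
  have := aseq_conv h0 h1 0 hm hm1
  simp [dcoef_zero] at this
  linarith

lemma aseq_mono {α : ℝ} (h0 : 0 < α) (h1 : α < 1) {m m' : ℝ} (hm : 0 ≤ m) (hmm : m ≤ m')
    (hm1 : m' < 1) (n : ℕ) : 0 ≤ aseq α m' n ∧ aseq α m' n ≤ aseq α m n := by
  have hm' := hm.trans hmm
  have hm2 := hmm.trans_lt hm1
  have key : ∀ a b c d : ℝ, (1 + m') * a = c → (1 + m) * b = d → 0 ≤ c → c ≤ d →
      0 ≤ a ∧ a ≤ b := by
    intro a b c d ha hb hc hd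
    have h : 0 ≤ a := by
      by_contra hneg
      push Not at hneg
      nlinarith
    refine ⟨h, ?_⟩
    by_contra hneg
    push Not at hneg
    nlinarith [mul_nonneg (sub_nonneg.2 hmm) h]
  induction n using Nat.strong_induction_on with
  | _ n ih =>
    cases n with
    | zero => exact key _ _ _ _ (aseq_rec_zero h0 h1 hm' hm1) (aseq_rec_zero h0 h1 hm hm2)
                zero_le_one le_rfl
    | succ n =>
      have hlt : ∀ p ∈ Finset.HasAntidiagonal.antidiagonal n, p.2 < n + 1 := fun p hp => by
        have := Finset.HasAntidiagonal.mem_antidiagonal.1 hp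
        omega
      refine key _ _ _ _ (aseq_rec h0 h1 n hm' hm1) (aseq_rec h0 h1 n hm hm2) ?_ ?_
      · refine add_nonneg (dcoef_nonneg (by linarith) _) (Finset.sum_nonneg fun p hp => ?_)
        exact mul_nonneg (neg_nonneg.2 (dcoef_neg h0 h1 _)) (ih _ (hlt p hp)).1
      · refine add_le_add le_rfl (Finset.sum_le_sum fun p hp => ?_)
        exact mul_le_mul_of_nonneg_left (ih _ (hlt p hp)).2 (neg_nonneg.2 (dcoef_neg h0 h1 _))

/-- Normalised coefficients. -/
noncomputable def qcoef (s : ℝ) (n : ℕ) : ℝ := dcoef (1 + s) n * (n : ℝ) ^ (-s)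

lemma qcoef_nonneg {s : ℝ} (hs : 0 ≤ s) (n : ℕ) : 0 ≤ qcoef s n :=
  mul_nonneg (dcoef_nonneg (by linarith) n) (by positivity)

lemma qcoef_succ_le {s : ℝ} (hs : 0 ≤ s) {n : ℕ} (hn : 1 ≤ n) : qcoef s (n + 1) ≤ qcoef s n := by
  have hn0 : (0 : ℝ) < n := by exact_mod_cast hn
  have hd : dcoef (1 + s) (n + 1) = (1 + s / (n + 1)) * dcoef (1 + s) n := by
    have := dcoef_succ (1 + s) n
    field_simp
    linarith
  have h1 : 1 + s / ((n : ℝ) + 1) ≤ (((n : ℝ) + 1) / n) ^ s := by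
    rw [Real.rpow_def_of_pos (by positivity)]
    have hl : 1 / ((n : ℝ) + 1) ≤ Real.log (((n : ℝ) + 1) / n) := by
      have := Real.one_sub_inv_le_log_of_pos (show 0 < ((n : ℝ) + 1) / n by positivity)
      refine le_trans (le_of_eq ?_) this
      field_simp
      ring
    have h2 := Real.add_one_le_exp (Real.log (((n : ℝ) + 1) / n) * s)
    have h3 := mul_le_mul_of_nonneg_right hl hs
    have h4 : 1 / ((n : ℝ) + 1) * s = s / (n + 1) := by ring
    linarith
  rw [Real.div_rpow (by positivity) (by positivity)] at h1
  rw [qcoef, qcoef, hd, Real.rpow_neg (by positivity), Real.rpow_neg (by positivity)]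
  push_cast
  have hA : 0 < ((n : ℝ) + 1) ^ s := by positivity
  have hB : 0 < (n : ℝ) ^ s := by positivity
  have hD := dcoef_nonneg (show 0 ≤ 1 + s by linarith) n
  calc (1 + s / ((n : ℝ) + 1)) * dcoef (1 + s) n * (((n : ℝ) + 1) ^ s)⁻¹
      ≤ (((n : ℝ) + 1) ^ s / (n : ℝ) ^ s) * dcoef (1 + s) n * (((n : ℝ) + 1) ^ s)⁻¹ := by gcongr
    _ = _ := by field_simp

lemma qcoef_le {s : ℝ} (hs : 0 ≤ s) {n₀ n : ℕ} (hn₀ : 1 ≤ n₀) (hn : n₀ ≤ n) :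
    qcoef s n ≤ qcoef s n₀ := by
  induction n, hn using Nat.le_induction with
  | base => exact le_rfl
  | succ n hn ih => exact (qcoef_succ_le hs (hn₀.trans hn)).trans ih

open Filter Topology in
lemma qcoef_tendsto {s : ℝ} (hs : 0 ≤ s) :
    Tendsto (qcoef s) atTop (𝓝 (1 / Real.Gamma (s + 1))) := by
  rcases hs.eq_or_lt with rfl | hs
  · have h : qcoef 0 = fun _ => 1 := by
      ext n
      simp only [qcoef, dcoef, add_zero, neg_zero, Real.rpow_zero, mul_one]
      refine Finset.prod_eq_one fun k _ => ?_
      rw [add_comm]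
      exact div_self (by positivity)
    rw [h]
    simp
  · rw [Real.Gamma_add_one hs.ne']
    have hG := Real.Gamma_pos_of_pos hs
    have h := ((Real.GammaSeq_tendsto_Gamma s).const_mul s).inv₀ (by positivity)
    rw [← one_div] at h
    refine h.congr' ?_
    filter_upwards [eventually_ge_atTop 1] with n hn
    have hn0 : (0 : ℝ) < n := by exact_mod_cast hn
    have hp : (∏ k ∈ Finset.range n, ((k : ℝ) + 1)) = n.factorial := by
      rw [← Finset.prod_range_add_one_eq_factorial]
      push_cast
      rfl
    rw [qcoef, dcoef, Real.GammaSeq, Finset.prod_range_succ', Finset.prod_div_distrib, hp,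
      Real.rpow_neg hn0.le]
    have hq : ∏ k ∈ Finset.range n, (s + ((k + 1 : ℕ) : ℝ)) = ∏ k ∈ Finset.range n, (1 + s + k) :=
      Finset.prod_congr rfl fun k _ => by push_cast; ring
    rw [hq]
    have hB : 0 < (n : ℝ) ^ s := by positivity
    have hF : 0 < (n.factorial : ℝ) := by positivity
    have hP : 0 < ∏ k ∈ Finset.range n, (1 + s + k) := Finset.prod_pos fun k _ => by positivity
    simp only [Nat.cast_zero, add_zero]
    field_simp

lemma aseq_term {α x : ℝ} (n j : ℕ) :
    (-(x * (n : ℝ) ^ (-α))) ^ j * dcoef (1 + α * j) n = (-x) ^ j * qcoef (α * j) n := by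
  rw [qcoef, ← neg_mul, mul_pow, ← Real.rpow_mul_natCast (by positivity)]
  rw [neg_mul]
  ring

open Filter Topology in
lemma small_tendsto {α : ℝ} (h0 : 0 < α) (x : ℝ) :
    Tendsto (fun n : ℕ => x * (n : ℝ) ^ (-α)) atTop (𝓝 0) := by
  simpa using ((tendsto_rpow_neg_atTop h0).comp tendsto_natCast_atTop_atTop).const_mul x

open Filter Topology in
lemma aseq_tendsto {α : ℝ} (h0 : 0 < α) (h1 : α < 1) {x : ℝ} (hx : 0 ≤ x) :
    Tendsto (fun n : ℕ => aseq α (x * (n : ℝ) ^ (-α)) n) atTop (𝓝 (mittagLeffler α (-x))) := by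
  obtain ⟨n₀, hlt, hn₀⟩ := (((small_tendsto h0 x).eventually_lt_const one_pos).and
    (eventually_ge_atTop 1)).exists
  have hs := summable_dcoef h0 h1 n₀ (show 0 ≤ x * (n₀ : ℝ) ^ (-α) by positivity) hlt
  simp only [aseq, aseq_term, mittagLeffler]
  refine tendsto_tsum_of_dominated_convergence hs (fun j => ?_) ?_
  · rw [div_eq_mul_one_div]
    exact (qcoef_tendsto (by positivity)).const_mul _
  · filter_upwards [eventually_ge_atTop n₀] with n hn j
    rw [norm_mul, norm_pow, norm_neg, Real.norm_of_nonneg hx,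
      Real.norm_of_nonneg (qcoef_nonneg (by positivity) n)]
    have := aseq_term (α := α) (x := -x) n₀ j
    rw [neg_mul, neg_neg, neg_neg] at this
    rw [this]
    exact mul_le_mul_of_nonneg_left (qcoef_le (by positivity) hn₀ hn) (by positivity)

open Filter Topology in
lemma mittagLeffler_mono {α : ℝ} (h0 : 0 < α) (h1 : α < 1) {x y : ℝ} (hx : 0 ≤ x) (hxy : x ≤ y) :
    0 ≤ mittagLeffler α (-y) ∧ mittagLeffler α (-y) ≤ mittagLeffler α (-x) := by
  have hy := hx.trans hxy
  have h : ∀ᶠ n : ℕ in atTop, 0 ≤ aseq α (y * (n : ℝ) ^ (-α)) n ∧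
      aseq α (y * (n : ℝ) ^ (-α)) n ≤ aseq α (x * (n : ℝ) ^ (-α)) n := by
    filter_upwards [(small_tendsto h0 y).eventually_lt_const one_pos] with n hn
    exact aseq_mono h0 h1 (by positivity) (by gcongr) hn n
  exact ⟨ge_of_tendsto (aseq_tendsto h0 h1 hy) (h.mono fun _ h => h.1),
    le_of_tendsto_of_tendsto (aseq_tendsto h0 h1 hy) (aseq_tendsto h0 h1 hx)
      (h.mono fun _ h => h.2)⟩

lemma multiplier_bound {H : Type*} [NormedAddCommGroup H] [InnerProductSpace ℝ H] [CompleteSpace H]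
    (φ : HilbertBasis ℕ ℝ H) (c : ℕ → ℝ) (C : ℝ) (hc : ∀ n, 0 ≤ c n ∧ c n ≤ C) (u₀ : H) :
    Summable (fun n : ℕ => c n • ⟪u₀, φ n⟫ • (φ n : H)) ∧
    ‖∑' n : ℕ, c n • ⟪u₀, φ n⟫ • (φ n : H)‖ ≤ C * ‖u₀‖ := by
  have hC : 0 ≤ C := (hc 0).1.trans (hc 0).2
  set g := C • φ.repr u₀ with hg
  have hle : ∀ n, ‖c n * ⟪u₀, φ n⟫‖ ≤ ‖g n‖ := fun n => by
    rw [hg, lp.coeFn_smul, Pi.smul_apply, φ.repr_apply_apply, real_inner_comm, smul_eq_mul,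
      norm_mul, norm_mul, Real.norm_of_nonneg (hc n).1, Real.norm_of_nonneg hC]
    exact mul_le_mul_of_nonneg_right (hc n).2 (norm_nonneg _)
  have hmem : Memℓp (fun n => c n * ⟪u₀, φ n⟫) 2 := by
    have h2 : 0 < (2 : ENNReal).toReal := by norm_num
    refine memℓp_gen (Summable.of_nonneg_of_le (fun n => by positivity) (fun n => ?_)
      ((lp.memℓp g).summable h2))
    exact Real.rpow_le_rpow (norm_nonneg _) (hle n) h2.le
  set f : lp (fun _ : ℕ => ℝ) 2 := ⟨_, hmem⟩ with hf
  have hsum := φ.hasSum_repr_symm f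
  have hfn : ∀ n, f n • φ n = c n • ⟪u₀, φ n⟫ • (φ n : H) := fun n => by
    rw [smul_smul]
  simp only [hfn] at hsum
  refine ⟨hsum.summable, ?_⟩
  rw [hsum.tsum_eq, LinearIsometryEquiv.norm_map]
  refine (lp.norm_mono (by norm_num) (y := g) hle).trans ?_
  rw [hg, norm_smul, LinearIsometryEquiv.norm_map, Real.norm_of_nonneg hC]

/-- **Decay of the Fourier-series solution**: for an orthonormal basis `(φ_n)` of a
separable real Hilbert space and eigenvalues `λ_n ≥ λ₁ > 0`, the series
`u(t) = ∑ₙ E_α(-λ_n t^α) (u₀|φ_n) φ_n` converges and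
`‖u(t)‖ ≤ E_α(-λ₁ t^α) ‖u₀‖` for every `t ≥ 0`. -/
theorem fourier_series_decay
    {H : Type*} [NormedAddCommGroup H] [InnerProductSpace ℝ H] [CompleteSpace H]
    [TopologicalSpace.SeparableSpace H]
    (α : ℝ) (hα : α ∈ Ioo (0:ℝ) 1)
    (φ : HilbertBasis ℕ ℝ H)
    (lam : ℕ → ℝ) (lam₁ : ℝ) (hlam₁ : 0 < lam₁) (hlam : ∀ n, lam₁ ≤ lam n)
    (u₀ : H) (t : ℝ) (ht : 0 ≤ t) :
    Summable (fun n : ℕ => mittagLeffler α (-(lam n) * t ^ α) • ⟪u₀, φ n⟫ • (φ n : H)) ∧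
    ‖∑' n : ℕ, mittagLeffler α (-(lam n) * t ^ α) • ⟪u₀, φ n⟫ • (φ n : H)‖
      ≤ mittagLeffler α (-lam₁ * t ^ α) * ‖u₀‖ := by
  have ht' : 0 ≤ t ^ α := Real.rpow_nonneg ht α
  refine multiplier_bound φ _ _ (fun n => ?_) u₀
  rw [neg_mul, neg_mul]
  exact mittagLeffler_mono hα.1 hα.2 (by positivity) (mul_le_mul_of_nonneg_right (hlam n) ht')
end
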